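/- There exists a unique ℤ-algebra homomorphism D_t : ⋀M → (⋀M)[[t]] from the exterior algebra of M to the ring of formal power series with coefficients in ⋀M such that D_t(ε^i) = Σ_{j≥0} ε^{i+j} t^j for every i ≥ 1 (where elements of ⋀M are identified with constant power series as needed). -/

import Mathlib

open ExteriorAlgebra

noncomputable section

/-- The exterior algebra over `ℤ` of the free `ℤ`-module `M` with basis `ε¹, ε², …`
indexed by the positive integers. -/
abbrev E : Type := ExteriorAlgebra ℤ (ℕ+ →₀ ℤ)

/-- `ε i` is the `i`-th basis element of `M`, viewed inside the exterior algebra. -/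
def ε (i : ℕ+) : E := ExteriorAlgebra.ι ℤ (Finsupp.single i 1)

/-- `sh i j` is the positive integer `i + j`, for `i : ℕ+` and `j : ℕ`. -/
def sh (i : ℕ+) (j : ℕ) : ℕ+ := ⟨(i : ℕ) + j, Nat.add_pos_left i.pos j⟩

/-- The linear map `m ↦ ∑ ι (f j m) tʲ` attached to a sequence of endomorphisms of `M`. -/
def ιSeries {R M : Type*} [CommRing R] [AddCommGroup M] [Module R M] (f : ℕ → M →ₗ[R] M) :
    M →ₗ[R] PowerSeries (ExteriorAlgebra R M) where
  toFun m := PowerSeries.mk fun j => ExteriorAlgebra.ι R (f j m)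
  map_add' x y := by ext n; simp
  map_smul' r x := by ext n; simp

theorem ιSeries_mul_self {R M : Type*} [CommRing R] [AddCommGroup M] [Module R M]
    (f : ℕ → M →ₗ[R] M) (m : M) : ιSeries f m * ιSeries f m = 0 := by
  ext n
  simp only [ιSeries, LinearMap.coe_mk, AddHom.coe_mk, PowerSeries.coeff_mul,
    PowerSeries.coeff_mk, map_zero]
  refine Finset.sum_involution (fun p _ => p.swap) ?_ ?_ ?_ ?_
  · intro p _
    exact ExteriorAlgebra.ι_add_mul_swap _ _
  · rintro ⟨a, b⟩ _ hne heq
    obtain rfl : b = a := congrArg Prod.fst heq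
    exact hne (ExteriorAlgebra.ι_sq_zero _)
  · intro p hp
    simpa [add_comm] using hp
  · intro p _
    exact p.swap_swap

/-- There exists a unique `ℤ`-algebra homomorphism `D_t : ⋀M → (⋀M)[[t]]` such that
`D_t (εⁱ) = ∑_{j ≥ 0} ε^{i+j} tʲ` for every `i ≥ 1`. -/
theorem schubert_derivation_exists_unique :
    ∃! Dt : E →ₐ[ℤ] PowerSeries E,
      ∀ i : ℕ+, Dt (ε i) = PowerSeries.mk fun j => ε (sh i j) := by
  refine ⟨ExteriorAlgebra.lift ℤ ⟨ιSeries fun j => Finsupp.lmapDomain ℤ ℤ fun i => sh i j,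
    ιSeries_mul_self _⟩, fun i => ?_, fun D hD => ?_⟩
  · ext n
    simp [ε, ιSeries]
  · refine ExteriorAlgebra.hom_ext (Finsupp.lhom_ext' fun i => LinearMap.ext_ring ?_)
    refine (hD i).trans ?_
    ext n
    simp [ε, ιSeries]

end
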